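/- Suppose the crossed-product conditions (C1)–(C5) hold; write S = R∗_{c,τ}G and regard R as a subring of S via r ↦ r·e. Let M and N be finitely generated free left R-modules. Then the map φ ↦ α(φ), where α(φ) is the S-linear map S⊗_R M → S⊗_R N determined by α(φ)(u ⊗ x) = Σ_g u·(τ(g⁻¹,g)⁻¹·g⁻¹) ⊗ φ_g(x), is a bijection from the set of finitely supported families φ = (φ_g)_{g∈G} of additive c_g-semilinear maps φ_g : M → N (i.e. φ_g(r·x) = c_g(r)·φ_g(x)) onto the set Hom_S(S⊗_R M, S⊗_R N) of S-linear maps. -/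

import Mathlib

universe u v

variable {R : Type u} [Ring R] {G : Type v} [Group G]

/-- (C1): `c_{τ(g,g')} ∘ c_{gg'} = c_g ∘ c_{g'}`, where `c_u` is conjugation by the unit `u`. -/
def CondC1 (c : G → R ≃+* R) (τ : G → G → Rˣ) : Prop :=
  ∀ (g g' : G) (r : R),
    (τ g g' : R) * c (g * g') r * (((τ g g')⁻¹ : Rˣ) : R) = c g (c g' r)

/-- (C2): `τ(g,g')·τ(gg',g'') = c_g(τ(g',g''))·τ(g,g'g'')`. -/
def CondC2 (c : G → R ≃+* R) (τ : G → G → Rˣ) : Prop :=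
  ∀ g g' g'' : G,
    (τ g g' : R) * ((τ (g * g') g'' : Rˣ) : R) =
      c g ((τ g' g'' : Rˣ) : R) * ((τ g (g' * g'') : Rˣ) : R)

/-- (C3): `c_e = id`. -/
def CondC3 (c : G → R ≃+* R) : Prop := c (1 : G) = RingEquiv.refl R

/-- (C4): `τ(e,g) = 1`. -/
def CondC4 (τ : G → G → Rˣ) : Prop := ∀ g : G, τ 1 g = 1

/-- (C5): `τ(g,e) = 1`. -/
def CondC5 (τ : G → G → Rˣ) : Prop := ∀ g : G, τ g 1 = 1


/-- The multiplication of the crossed product `R ∗_{c,τ} G` on the free left `R`-module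
`G →₀ R` on `G`: the unique biadditive map with
`(λ·g)·(μ·h) = (λ · c_g(μ) · τ(g,h)) · (gh)`. -/
noncomputable def crossedMul (c : G → R ≃+* R) (τ : G → G → Rˣ) (x y : G →₀ R) : G →₀ R :=
  x.sum fun g r => y.sum fun h s => Finsupp.single (g * h) (r * c g s * ((τ g h : Rˣ) : R))

universe w

/-- The action of the crossed product `S = R ∗_{c,τ} G` on `S ⊗_R M`, where `S ⊗_R M` is
realised as `G →₀ M` via the identification `(λ·g) ⊗ x = (1·g) ⊗ c_g⁻¹(λ)·x` (the element
`Finsupp.single g x` corresponds to `(1·g) ⊗ x`, and `Finsupp.single 1 x` to `1 ⊗ x`). -/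
noncomputable def crossedSMul (c : G → R ≃+* R) (τ : G → G → Rˣ)
    {M : Type w} [AddCommGroup M] [Module R M]
    (u : G →₀ R) (z : G →₀ M) : G →₀ M :=
  u.sum fun g r => z.sum fun h x =>
    Finsupp.single (g * h) (((c (g * h)).symm (r * ((τ g h : Rˣ) : R))) • x)

/-- The characterising property of the map `α(φ) : S ⊗_R M → S ⊗_R N`. -/
def IsInducedHom (c : G → R ≃+* R) (τ : G → G → Rˣ)
    {M N : Type w} [AddCommGroup M] [Module R M] [AddCommGroup N] [Module R N]
    (φ : G → M → N) (A : (G →₀ M) → (G →₀ N)) : Prop :=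
  (∀ z z' : G →₀ M, A (z + z') = A z + A z') ∧
  (∀ (u : G →₀ R) (z : G →₀ M), A (crossedSMul c τ u z) = crossedSMul c τ u (A z)) ∧
  (∀ (u : G →₀ R) (x : M),
    A (crossedSMul c τ u (Finsupp.single (1 : G) x)) =
      ∑ᶠ g : G,
        crossedSMul c τ
          (crossedMul c τ u (Finsupp.single g⁻¹ (((τ g⁻¹ g)⁻¹ : Rˣ) : R)))
          (Finsupp.single (1 : G) (φ g x)))

section CrossedModule

variable {c : G → R ≃+* R} {τ : G → G → Rˣ}
  {M N : Type w} [AddCommGroup M] [Module R M] [AddCommGroup N] [Module R N]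

theorem crossedSMul_add (u : G →₀ R) (z z' : G →₀ M) :
    crossedSMul c τ u (z + z') = crossedSMul c τ u z + crossedSMul c τ u z' := by
  unfold crossedSMul
  rw [← Finsupp.sum_add]
  refine Finsupp.sum_congr fun g _ => Finsupp.sum_add_index' ?_ ?_
  · simp
  · intro h x y
    rw [smul_add, Finsupp.single_add]

theorem add_crossedSMul (u u' : G →₀ R) (z : G →₀ M) :
    crossedSMul c τ (u + u') z = crossedSMul c τ u z + crossedSMul c τ u' z := by
  unfold crossedSMul
  refine Finsupp.sum_add_index' ?_ ?_
  · simp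
  · intro g r s
    rw [← Finsupp.sum_add]
    refine Finsupp.sum_congr fun h _ => ?_
    rw [add_mul, map_add, add_smul, Finsupp.single_add]

@[simp]
theorem zero_crossedSMul (z : G →₀ M) : crossedSMul c τ 0 z = 0 := by
  simp [crossedSMul]

@[simp]
theorem crossedSMul_zero (u : G →₀ R) : crossedSMul c τ u (0 : G →₀ M) = 0 := by
  simp [crossedSMul]

theorem crossedSMul_single (g h : G) (r : R) (x : M) :
    crossedSMul c τ (Finsupp.single g r) (Finsupp.single h x) =
      Finsupp.single (g * h) (((c (g * h)).symm (r * ((τ g h : Rˣ) : R))) • x) := by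
  simp [crossedSMul]

theorem crossedMul_add (u v w : G →₀ R) :
    crossedMul c τ u (v + w) = crossedMul c τ u v + crossedMul c τ u w := by
  unfold crossedMul
  rw [← Finsupp.sum_add]
  refine Finsupp.sum_congr fun g _ => Finsupp.sum_add_index' ?_ ?_
  · simp
  · intro h x y
    rw [map_add, mul_add, add_mul, Finsupp.single_add]

theorem add_crossedMul (u v w : G →₀ R) :
    crossedMul c τ (u + v) w = crossedMul c τ u w + crossedMul c τ v w := by
  unfold crossedMul
  refine Finsupp.sum_add_index' ?_ ?_
  · simp
  · intro g r s
    rw [← Finsupp.sum_add]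
    refine Finsupp.sum_congr fun h _ => ?_
    rw [add_mul, add_mul, Finsupp.single_add]

@[simp]
theorem zero_crossedMul (w : G →₀ R) : crossedMul c τ 0 w = 0 := by
  simp [crossedMul]

@[simp]
theorem crossedMul_zero (u : G →₀ R) : crossedMul c τ u 0 = 0 := by
  simp [crossedMul]

theorem crossedMul_single (g h : G) (r s : R) :
    crossedMul c τ (Finsupp.single g r) (Finsupp.single h s) =
      Finsupp.single (g * h) (r * c g s * ((τ g h : Rˣ) : R)) := by
  simp [crossedMul]

/-- The action of the crossed product on `S ⊗_R M` is associative. -/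
theorem crossedMul_crossedSMul (h1 : CondC1 c τ) (h2 : CondC2 c τ)
    (u v : G →₀ R) (z : G →₀ M) :
    crossedSMul c τ (crossedMul c τ u v) z = crossedSMul c τ u (crossedSMul c τ v z) := by
  induction u using Finsupp.induction_linear with
  | zero => simp
  | add u u' hu hu' => simp only [add_crossedMul, add_crossedSMul, hu, hu']
  | single g a =>
  induction v using Finsupp.induction_linear with
  | zero => simp
  | add v v' hv hv' => simp only [crossedMul_add, add_crossedSMul, crossedSMul_add, hv, hv']
  | single h b =>
  induction z using Finsupp.induction_linear with
  | zero => simp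
  | add z z' hz hz' => simp only [crossedSMul_add, hz, hz']
  | single k x =>
  simp only [crossedMul_single, crossedSMul_single, smul_smul, mul_assoc g h k]
  congr 2
  apply (c (g * (h * k))).injective
  have key := h1 g (h * k) ((c (h * k)).symm (b * τ h k))
  rw [RingEquiv.apply_symm_apply] at key
  have key' := (Units.mul_inv_eq_iff_eq_mul _).1 key
  simp only [map_mul, RingEquiv.apply_symm_apply] at key' ⊢
  simp only [mul_assoc] at key' ⊢
  rw [key', h2 g h k]

theorem single_one_crossedSMul (h3 : CondC3 c) (h4 : CondC4 τ) (r : R) (x : M) :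
    crossedSMul c τ (Finsupp.single 1 r) (Finsupp.single 1 x) = Finsupp.single 1 (r • x) := by
  have h : c 1 = RingEquiv.refl R := h3
  simp [crossedSMul_single, h, h4 1]

theorem crossedSMul_single_one (h5 : CondC5 τ) (g : G) (r : R) (x : M) :
    crossedSMul c τ (Finsupp.single g r) (Finsupp.single 1 x) =
      Finsupp.single g ((c g).symm r • x) := by
  simp [crossedSMul_single, h5 g]

theorem one_crossedSMul (h4 : CondC4 τ) (z : G →₀ M) :
    crossedSMul c τ (Finsupp.single 1 1) z = z := by
  induction z using Finsupp.induction_linear with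
  | zero => simp
  | add z z' hz hz' => rw [crossedSMul_add, hz, hz']
  | single k x => simp [crossedSMul_single, h4 k]

/-- An `R`-linear map `M → S ⊗_R N` extends to an `S`-linear map `S ⊗_R M → S ⊗_R N`. -/
theorem exists_crossedLinear_extension (h1 : CondC1 c τ) (h2 : CondC2 c τ)
    (h4 : CondC4 τ) (h5 : CondC5 τ) (L : M →+ (G →₀ N))
    (hL : ∀ (r : R) (x : M), L (r • x) = crossedSMul c τ (Finsupp.single 1 r) (L x)) :
    ∃ A : (G →₀ M) → (G →₀ N),
      (∀ z z' : G →₀ M, A (z + z') = A z + A z') ∧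
      (∀ (u : G →₀ R) (z : G →₀ M), A (crossedSMul c τ u z) = crossedSMul c τ u (A z)) ∧
      ∀ x : M, A (Finsupp.single 1 x) = L x := by
  let A : (G →₀ M) → (G →₀ N) := fun z =>
    z.sum fun h x => crossedSMul c τ (Finsupp.single h 1) (L x)
  have hA0 : A 0 = 0 := by simp [A]
  have hA : ∀ z z', A (z + z') = A z + A z' := fun z z' =>
    Finsupp.sum_add_index' (by simp) fun h x y => by rw [map_add, crossedSMul_add]
  have hAs : ∀ h x, A (Finsupp.single h x) = crossedSMul c τ (Finsupp.single h 1) (L x) :=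
    fun h x => Finsupp.sum_single_index (by simp)
  refine ⟨A, hA, fun u z => ?_, fun x => by rw [hAs, one_crossedSMul h4]⟩
  induction u using Finsupp.induction_linear with
  | zero => simp [hA0]
  | add u u' hu hu' => simp only [add_crossedSMul, hA, hu, hu']
  | single g r =>
  induction z using Finsupp.induction_linear with
  | zero => simp [hA0]
  | add z z' hz hz' => simp only [crossedSMul_add, hA, hz, hz']
  | single h x =>
  rw [crossedSMul_single, hAs, hAs, hL, ← crossedMul_crossedSMul h1 h2,
    ← crossedMul_crossedSMul h1 h2, crossedMul_single, crossedMul_single]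
  simp [h5 (g * h)]

/-- An `S`-linear map out of `S ⊗_R M` is determined by its values on `1 ⊗ x`. -/
theorem crossedLinear_ext (h5 : CondC5 τ) {A B : (G →₀ M) → (G →₀ N)}
    (hA : ∀ z z' : G →₀ M, A (z + z') = A z + A z')
    (hAS : ∀ (u : G →₀ R) (z : G →₀ M), A (crossedSMul c τ u z) = crossedSMul c τ u (A z))
    (hB : ∀ z z' : G →₀ M, B (z + z') = B z + B z')
    (hBS : ∀ (u : G →₀ R) (z : G →₀ M), B (crossedSMul c τ u z) = crossedSMul c τ u (B z))
    (h : ∀ x : M, A (Finsupp.single 1 x) = B (Finsupp.single 1 x)) : A = B := by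
  funext z
  induction z using Finsupp.induction_linear with
  | zero => simpa using h 0
  | add z z' hz hz' => rw [hA, hB, hz, hz']
  | single k x =>
    have hk : Finsupp.single k x =
        crossedSMul c τ (Finsupp.single k 1) (Finsupp.single 1 x) := by
      simp [crossedSMul_single_one h5]
    rw [hk, hAS, hBS, h]

theorem finsum_single_inv_apply {y : G → N} (hy : (Function.support y).Finite) (g : G) :
    (∑ᶠ k : G, Finsupp.single k⁻¹ (y k)) g⁻¹ = y g := by
  classical
  have hs : (Function.support fun k : G => Finsupp.single k⁻¹ (y k)).Finite :=
    hy.subset fun k hk hk' => hk (by simp [hk'])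
  have := (Finsupp.applyAddHom (M := N) g⁻¹).map_finsum hs
  simp only [Finsupp.applyAddHom_apply] at this
  rw [this, finsum_eq_single _ g]
  · simp
  · intro k hk
    simp [hk]

/-- The coefficients of `α(φ)(1 ⊗ x)`. -/
theorem IsInducedHom.apply_single_one (h3 : CondC3 c) (h4 : CondC4 τ) (h5 : CondC5 τ)
    {φ : G → M → N} (hφ : (Function.support φ).Finite) {A : (G →₀ M) → (G →₀ N)}
    (hA : IsInducedHom c τ φ A) (x : M) (g : G) :
    A (Finsupp.single 1 x) g⁻¹ =
      (c g⁻¹).symm (((τ g⁻¹ g)⁻¹ : Rˣ) : R) • φ g x := by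
  have h := hA.2.2 (Finsupp.single 1 1) x
  have hc : c 1 = RingEquiv.refl R := h3
  have hτ : ∀ k, τ 1 k = 1 := h4
  simp only [crossedMul_single, crossedSMul_single_one h5, one_mul, hτ, Units.val_one, mul_one,
    map_one, one_smul, hc, RingEquiv.refl_apply] at h
  rw [h]
  refine finsum_single_inv_apply
    (y := fun k => (c k⁻¹).symm (((τ k⁻¹ k)⁻¹ : Rˣ) : R) • φ k x) (hφ.subset ?_) g
  intro k hk hk'
  exact hk (by simp [hk'])

/-- On `R`, the automorphism `c_g` is the inverse of `c_{g⁻¹}` up to conjugation. -/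
theorem symm_inv_apply (h1 : CondC1 c τ) (h3 : CondC3 c) (g : G) (r : R) :
    (c g⁻¹).symm ((τ g⁻¹ g : Rˣ) : R) * (c g⁻¹).symm r =
      c g r * (c g⁻¹).symm ((τ g⁻¹ g : Rˣ) : R) := by
  have hc : c 1 = RingEquiv.refl R := h3
  have key := h1 g⁻¹ g r
  rw [inv_mul_cancel, hc, RingEquiv.refl_apply] at key
  apply (c g⁻¹).injective
  simp only [map_mul, RingEquiv.apply_symm_apply]
  exact (Units.mul_inv_eq_iff_eq_mul _).1 key

theorem symm_inv_apply_inv (h1 : CondC1 c τ) (h3 : CondC3 c) (g : G) (r : R) :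
    (c g⁻¹).symm r * (c g⁻¹).symm (((τ g⁻¹ g)⁻¹ : Rˣ) : R) =
      (c g⁻¹).symm (((τ g⁻¹ g)⁻¹ : Rˣ) : R) * c g r := by
  have hc : c 1 = RingEquiv.refl R := h3
  have key := h1 g⁻¹ g r
  rw [inv_mul_cancel, hc, RingEquiv.refl_apply] at key
  apply (c g⁻¹).injective
  simp only [map_mul, RingEquiv.apply_symm_apply]
  rw [← key, mul_assoc, Units.inv_mul_cancel_left]

/-- Every finitely supported family of `c_g`-semilinear maps induces an `S`-linear map. -/
theorem exists_isInducedHom (h1 : CondC1 c τ) (h2 : CondC2 c τ) (h3 : CondC3 c)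
    (h4 : CondC4 τ) (h5 : CondC5 τ) {φ : G → M → N} (hφ : (Function.support φ).Finite)
    (hadd : ∀ (g : G) (x y : M), φ g (x + y) = φ g x + φ g y)
    (hsmul : ∀ (g : G) (r : R) (x : M), φ g (r • x) = c g r • φ g x) :
    ∃ A : (G →₀ M) → (G →₀ N), IsInducedHom c τ φ A := by
  let t : G → M → (G →₀ N) := fun g x =>
    crossedSMul c τ (Finsupp.single g⁻¹ (((τ g⁻¹ g)⁻¹ : Rˣ) : R)) (Finsupp.single 1 (φ g x))
  have htadd : ∀ g x y, t g (x + y) = t g x + t g y := fun g x y => by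
    simp only [t, hadd, Finsupp.single_add, crossedSMul_add]
  have htsmul : ∀ g (r : R) x,
      t g (r • x) = crossedSMul c τ (Finsupp.single 1 r) (t g x) := fun g r x => by
    simp only [t, crossedSMul_single_one h5, crossedSMul_single, hsmul, one_mul, h4 g⁻¹,
      Units.val_one, mul_one, smul_smul, symm_inv_apply_inv h1 h3]
  have ht : ∀ x, (Function.support fun g => t g x).Finite := fun x =>
    hφ.subset fun g hg hg' => hg (by simp [t, hg'])
  let act : (G →₀ R) → (G →₀ N) →+ (G →₀ N) := fun u =>
    AddMonoidHom.mk' (crossedSMul c τ u) (crossedSMul_add u)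
  let L : M →+ (G →₀ N) := AddMonoidHom.mk' (fun x => ∑ᶠ g, t g x) fun x y => by
    simp only [htadd]
    exact finsum_add_distrib (ht x) (ht y)
  have hL : ∀ (r : R) (x : M),
      L (r • x) = crossedSMul c τ (Finsupp.single 1 r) (L x) := fun r x => by
    have := (act (Finsupp.single 1 r)).map_finsum (ht x)
    simp only [act, AddMonoidHom.mk'_apply] at this
    simp only [L, AddMonoidHom.mk'_apply, this, htsmul]
  obtain ⟨A, hA, hAS, hA1⟩ := exists_crossedLinear_extension h1 h2 h4 h5 L hL
  refine ⟨A, hA, hAS, fun u x => ?_⟩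
  have := (act u).map_finsum (ht x)
  simp only [act, AddMonoidHom.mk'_apply] at this
  simp only [hAS, hA1, L, AddMonoidHom.mk'_apply, this, t, crossedMul_crossedSMul h1 h2]

/-- A family of semilinear maps out of a finitely generated module, finitely many of which are
nonzero at each point, is finitely supported. -/
theorem finite_support_of_semilinear {ι : Type*} [Module.Finite R M]
    {c : ι → R ≃+* R} {φ : ι → M → N}
    (hadd : ∀ (g : ι) (x y : M), φ g (x + y) = φ g x + φ g y)
    (hsmul : ∀ (g : ι) (r : R) (x : M), φ g (r • x) = c g r • φ g x)
    (hfin : ∀ x : M, (Function.support fun g => φ g x).Finite) :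
    (Function.support φ).Finite := by
  obtain ⟨s, hs⟩ := Module.Finite.fg_top (R := R) (M := M)
  refine (s.finite_toSet.biUnion fun x _ => hfin x).subset fun g hg => ?_
  by_contra hg'
  simp only [Set.mem_iUnion, Function.mem_support, not_exists, not_not] at hg'
  refine hg (funext fun x => ?_)
  have hx : x ∈ Submodule.span R (s : Set M) := hs ▸ Submodule.mem_top
  induction hx using Submodule.span_induction with
  | mem x hx => exact hg' x hx
  | zero => simpa using hsmul g 0 0
  | add x y _ _ hx hy => simp [hadd, hx, hy]
  | smul r x _ hx => simp [hsmul, hx]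

end CrossedModule

/-- under (C1)–(C5), for finitely generated free left `R`-modules `M` and `N`,
the assignment `φ ↦ α(φ)` is a bijection from the set of finitely supported families
`φ = (φ_g)_{g ∈ G}` of additive `c_g`-semilinear maps `M → N` onto the set of `S`-linear maps
`S ⊗_R M → S ⊗_R N`, where `S = R ∗_{c,τ} G`. -/
theorem induced_hom_bijective
    (c : G → R ≃+* R) (τ : G → G → Rˣ)
    (h1 : CondC1 c τ) (h2 : CondC2 c τ) (h3 : CondC3 c) (h4 : CondC4 τ) (h5 : CondC5 τ)
    {M N : Type w} [AddCommGroup M] [Module R M] [AddCommGroup N] [Module R N]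
    [Module.Free R M] [Module.Finite R M] [Module.Free R N] [Module.Finite R N] :
    ∃ Θ : {φ : G → M → N //
            (Function.support φ).Finite ∧
            (∀ (g : G) (x y : M), φ g (x + y) = φ g x + φ g y) ∧
            (∀ (g : G) (r : R) (x : M), φ g (r • x) = c g r • φ g x)} →
          {A : (G →₀ M) → (G →₀ N) //
            (∀ z z' : G →₀ M, A (z + z') = A z + A z') ∧
            (∀ (u : G →₀ R) (z : G →₀ M),
              A (crossedSMul c τ u z) = crossedSMul c τ u (A z))},
      (∀ φ, IsInducedHom c τ (φ : _).1 ((Θ φ) : _).1) ∧ Function.Bijective Θ := by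
  have hex (φ : {φ : G → M → N //
      (Function.support φ).Finite ∧
      (∀ (g : G) (x y : M), φ g (x + y) = φ g x + φ g y) ∧
      (∀ (g : G) (r : R) (x : M), φ g (r • x) = c g r • φ g x)}) :
      ∃ A : {A : (G →₀ M) → (G →₀ N) //
        (∀ z z' : G →₀ M, A (z + z') = A z + A z') ∧
        (∀ (u : G →₀ R) (z : G →₀ M),
          A (crossedSMul c τ u z) = crossedSMul c τ u (A z))}, IsInducedHom c τ φ.1 A.1 := by
    obtain ⟨A, hA⟩ := exists_isInducedHom h1 h2 h3 h4 h5 φ.2.1 φ.2.2.1 φ.2.2.2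
    exact ⟨⟨A, hA.1, hA.2.1⟩, hA⟩
  choose Θ hΘ using hex
  have coeff := fun φ => (hΘ φ).apply_single_one h3 h4 h5 φ.2.1
  refine ⟨Θ, hΘ, fun φ ψ h => ?_, fun ⟨A, hA, hAS⟩ => ?_⟩
  · refine Subtype.ext (funext fun g => funext fun x => ?_)
    have hx := coeff φ x g
    rw [h, coeff ψ x g] at hx
    have hx' := congrArg (fun y => (c g⁻¹).symm ((τ g⁻¹ g : Rˣ) : R) • y) hx
    simpa [smul_smul, ← map_mul] using hx'.symm
  · let φ : G → M → N := fun g x =>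
      (c g⁻¹).symm ((τ g⁻¹ g : Rˣ) : R) • A (Finsupp.single 1 x) g⁻¹
    have hadd : ∀ g x y, φ g (x + y) = φ g x + φ g y := fun g x y => by
      simp [φ, Finsupp.single_add, hA]
    have hone : ∀ (r : R) (z : G →₀ N) (g : G),
        crossedSMul c τ (Finsupp.single 1 r) z g = (c g).symm r • z g := fun r z g => by
      classical
      induction z using Finsupp.induction_linear with
      | zero => simp
      | add z z' hz hz' => simp [crossedSMul_add, hz, hz']
      | single k x =>
        by_cases hk : k = g
        · subst hk
          simp [crossedSMul_single, h4 k]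
        · simp [crossedSMul_single, hk]
    have hsmul : ∀ g (r : R) x, φ g (r • x) = c g r • φ g x := fun g r x => by
      simp only [φ]
      rw [← single_one_crossedSMul h3 h4, hAS, hone, smul_smul, smul_smul,
        symm_inv_apply h1 h3]
    have hfin : ∀ x, (Function.support fun g => φ g x).Finite := fun x => by
      refine ((A (Finsupp.single 1 x)).support.finite_toSet.preimage
        (inv_injective.injOn)).subset fun g hg => ?_
      simp only [Set.mem_preimage, Finset.mem_coe, Finsupp.mem_support_iff]
      exact fun h0 => hg (by simp [φ, h0])
    refine ⟨⟨φ, finite_support_of_semilinear hadd hsmul hfin, hadd, hsmul⟩, Subtype.ext ?_⟩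
    refine crossedLinear_ext h5 (hΘ _).1 (hΘ _).2.1 hA hAS fun x => Finsupp.ext fun k => ?_
    have hk := coeff ⟨φ, finite_support_of_semilinear hadd hsmul hfin, hadd, hsmul⟩ x k⁻¹
    rw [inv_inv] at hk
    rw [hk]
    simp [φ, smul_smul, ← map_mul]
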